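/- For every g ∈ H and every a ∈ A, the commutator [ζ(g), j(a)] vanishes in B, i.e. ζ(g) · j(a) = j(a) · ζ(g); in other words the subalgebra ζ(H) of B commutes elementwise with the subalgebra j(A). -/

import Mathlib

/-!
Context: `H` is a Hopf algebra over a field `k`, `A` is a right `H`-module algebra,
`B` is a model of the cross product `A ⋊ H`, `f : H → A` is a realization of `H` in `A`,
and `ζ : H → B` is defined by `ζ(g) = Σ ι(g₍₁₎) · j(f(S g₍₂₎))`.
-/

open TensorProduct

/-- A right module-algebra action of a Hopf algebra `H` on a unital associative
`k`-algebra `A`: a `k`-bilinear map `◁ : A × H → A` (curried as `act`) such that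
`a ◁ (g g') = (a ◁ g) ◁ g'`, `a ◁ 1 = a`,
`(a a') ◁ g = Σ (a ◁ g₍₁₎)(a' ◁ g₍₂₎)` and `1 ◁ g = ε(g) 1`. -/
structure RightModuleAlgebra (k H A : Type*) [CommRing k] [Ring H] [Ring A]
    [HopfAlgebra k H] [Algebra k A] where
  act : A →ₗ[k] H →ₗ[k] A
  act_mul : ∀ (a : A) (g g' : H), act a (g * g') = act (act a g) g'
  act_one : ∀ a : A, act a 1 = a
  mul_act : ∀ (a a' : A) (g : H),
    act (a * a') g =
      LinearMap.mul' k A (TensorProduct.map (act a) (act a') (Coalgebra.comul (R := k) g))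
  one_act : ∀ g : H, act 1 g = algebraMap k A (Coalgebra.counit (R := k) g)

/-- A model of the cross product algebra `A ⋊ H`: a unital associative `k`-algebra `B`
with algebra maps `j : A → B`, `ι : H → B` such that `g ⊗ a ↦ ι(g) j(a)` is a linear
isomorphism `H ⊗ₖ A ≃ B` and `j(a) ι(g) = Σ ι(g₍₁₎) j(a ◁ g₍₂₎)`. -/
structure CrossProductModel (k H A B : Type*) [CommRing k] [Ring H] [Ring A] [Ring B]
    [HopfAlgebra k H] [Algebra k A] [Algebra k B]
    (ma : RightModuleAlgebra k H A) where
  j : A →ₐ[k] B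
  ι : H →ₐ[k] B
  mul_bij : Function.Bijective
    ((LinearMap.mul' k B) ∘ₗ (TensorProduct.map ι.toLinearMap j.toLinearMap))
  straighten : ∀ (a : A) (g : H),
    j a * ι g =
      LinearMap.mul' k B
        (TensorProduct.map ι.toLinearMap (j.toLinearMap ∘ₗ ma.act a)
          (Coalgebra.comul (R := k) g))

/-- A realization of `H` in `A`: an algebra homomorphism `f : H → A` such that
`a · f(g) = Σ f(g₍₁₎) · (a ◁ g₍₂₎)` for all `a ∈ A`, `g ∈ H`. -/
def IsRealization {k H A : Type*} [CommRing k] [Ring H] [Ring A]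
    [HopfAlgebra k H] [Algebra k A]
    (ma : RightModuleAlgebra k H A) (f : H →ₐ[k] A) : Prop :=
  ∀ (a : A) (g : H),
    a * f g =
      LinearMap.mul' k A
        (TensorProduct.map f.toLinearMap (ma.act a) (Coalgebra.comul (R := k) g))

/-- The map `ζ : H → B`, `ζ(g) = Σ ι(g₍₁₎) · j(f(S g₍₂₎))`. -/
noncomputable def zeta {k H A B : Type*} [CommRing k] [Ring H] [Ring A] [Ring B]
    [HopfAlgebra k H] [Algebra k A] [Algebra k B]
    {ma : RightModuleAlgebra k H A} (cp : CrossProductModel k H A B ma)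
    (f : H →ₐ[k] A) : H →ₗ[k] B :=
  LinearMap.mul' k B ∘ₗ
    TensorProduct.map cp.ι.toLinearMap
      (cp.j.toLinearMap ∘ₗ f.toLinearMap ∘ₗ (HopfAlgebra.antipode (R := k) (A := H))) ∘ₗ
    Coalgebra.comul (R := k)


open Coalgebra WithConv

section Convolution

variable {R C A : Type*} [CommRing R] [AddCommGroup C] [Module R C] [Coalgebra R C]
  [Ring A] [Algebra R A]

/-- The linear map `c ↦ ε(c) a`, viewed in the convolution algebra. -/
noncomputable def convConst (R C : Type*) {A : Type*} [CommRing R] [AddCommGroup C] [Module R C]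
    [Coalgebra R C] [Ring A] [Algebra R A] (a : A) : WithConv (C →ₗ[R] A) :=
  toConv (LinearMap.toSpanSingleton R A a ∘ₗ counit)

lemma convConst_apply (a : A) (c : C) : convConst R C a c = counit (R := R) c • a := rfl

lemma convConst_mul_apply (a : A) (φ : WithConv (C →ₗ[R] A)) (c : C) :
    (convConst R C a * φ) c = a * φ c := by
  have h := congr(a * φ.ofConv $(sum_counit_smul (ℛ R c)))
  simp only [map_sum, map_smul, Finset.mul_sum, mul_smul_comm] at h
  rw [(ℛ R c).convMul_apply]
  simp only [convConst_apply, smul_mul_assoc]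
  exact h

lemma mul_convConst_apply (a : A) (φ : WithConv (C →ₗ[R] A)) (c : C) :
    (φ * convConst R C a) c = φ c * a := by
  have hc : ∑ i ∈ (ℛ R c).index, counit (R := R) ((ℛ R c).right i) • (ℛ R c).left i = c := by
    simpa only [map_sum, TensorProduct.rid_tmul, one_smul]
      using congr(TensorProduct.rid R C $(sum_tmul_counit_eq (ℛ R c)))
  have h := congrArg (fun x => φ.ofConv x * a) hc
  simp only [map_sum, map_smul, Finset.sum_mul, smul_mul_assoc] at h
  rw [(ℛ R c).convMul_apply]
  simp only [convConst_apply, mul_smul_comm]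
  exact h

end Convolution

section Realization

variable {k H A : Type*} [CommRing k] [Ring H] [Ring A] [HopfAlgebra k H] [Algebra k A]

lemma AlgHom.antipode_convMul_self (f : H →ₐ[k] A) :
    toConv (f.toLinearMap ∘ₗ HopfAlgebra.antipode k) * toConv f.toLinearMap = 1 := by
  have h := LinearMap.algHom_comp_convMul_distrib f
    (toConv (HopfAlgebra.antipode k (A := H))) (toConv LinearMap.id)
  rw [LinearMap.antipode_mul_id] at h
  apply WithConv.ofConv_injective
  refine h.symm.trans ?_
  ext x
  simp [LinearMap.convOne_def]

lemma AlgHom.self_convMul_antipode (f : H →ₐ[k] A) :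
    toConv f.toLinearMap * toConv (f.toLinearMap ∘ₗ HopfAlgebra.antipode k) = 1 := by
  have h := LinearMap.algHom_comp_convMul_distrib f
    (toConv LinearMap.id) (toConv (HopfAlgebra.antipode k (A := H)))
  rw [LinearMap.id_mul_antipode] at h
  apply WithConv.ofConv_injective
  refine h.symm.trans ?_
  ext x
  simp [LinearMap.convOne_def]

/-- In the convolution algebra, `Σ (a ◁ g₍₁₎) f(S g₍₂₎) = f(S g) a`. -/
lemma IsRealization.act_convMul_antipode {ma : RightModuleAlgebra k H A} {f : H →ₐ[k] A}
    (hf : IsRealization ma f) (a : A) :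
    toConv (ma.act a) * toConv (f.toLinearMap ∘ₗ HopfAlgebra.antipode k) =
      toConv (f.toLinearMap ∘ₗ HopfAlgebra.antipode k) * convConst k H a := by
  set F := toConv f.toLinearMap
  set G := toConv (f.toLinearMap ∘ₗ HopfAlgebra.antipode k)
  have hGF : G * F = 1 := f.antipode_convMul_self
  have hFG : F * G = 1 := f.self_convMul_antipode
  have hF : convConst k H a * F = F * toConv (ma.act a) := by
    ext g
    exact (convConst_mul_apply a F g).trans (hf a g)
  calc toConv (ma.act a) * G = G * (F * toConv (ma.act a)) * G := by
        rw [← mul_assoc, hGF, one_mul]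
    _ = G * convConst k H a := by rw [← hF, mul_assoc, mul_assoc, hFG, mul_one]

end Realization

/-- for every `g ∈ H` and `a ∈ A` the commutator `[ζ(g), j(a)]` vanishes
in `B`, i.e. `ζ(g) j(a) = j(a) ζ(g)`: the subalgebra `ζ(H)` commutes elementwise with
the subalgebra `j(A)`. -/
theorem zeta_commutes_with_j {k H A B : Type*} [Field k] [Ring H] [Ring A] [Ring B]
    [HopfAlgebra k H] [Algebra k A] [Algebra k B]
    (ma : RightModuleAlgebra k H A) (cp : CrossProductModel k H A B ma)
    (f : H →ₐ[k] A) (hf : IsRealization ma f) :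
    ∀ (g : H) (a : A), zeta cp f g * cp.j a = cp.j a * zeta cp f g := by
  intro g a
  set G := toConv (f.toLinearMap ∘ₗ HopfAlgebra.antipode k (A := H))
  set I := toConv cp.ι.toLinearMap
  set jG := toConv (cp.j.toLinearMap ∘ₗ G.ofConv)
  set jact := toConv (cp.j.toLinearMap ∘ₗ ma.act a)
  have hzeta : toConv (zeta cp f) = I * jG := rfl
  have hI : convConst k H (cp.j a) * I = I * jact := by
    ext x
    exact (convConst_mul_apply (cp.j a) I x).trans (cp.straighten a x)
  have hconst : toConv (cp.j.toLinearMap ∘ₗ (convConst k H a).ofConv) =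
      convConst k H (cp.j a) := by
    ext x
    exact map_smul cp.j _ a
  have hjG : jact * jG = jG * convConst k H (cp.j a) := by
    have h := congr(cp.j.toLinearMap ∘ₗ ($(hf.act_convMul_antipode a)).ofConv)
    rw [LinearMap.algHom_comp_convMul_distrib, LinearMap.algHom_comp_convMul_distrib,
      hconst] at h
    exact WithConv.ofConv_injective h
  have key : toConv (zeta cp f) * convConst k H (cp.j a) =
      convConst k H (cp.j a) * toConv (zeta cp f) := by
    rw [hzeta, mul_assoc, ← hjG, ← mul_assoc, ← hI, mul_assoc]
  exact (mul_convConst_apply (cp.j a) (toConv (zeta cp f)) g).symm.trans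
    ((DFunLike.congr_fun (congrArg ofConv key) g).trans
      (convConst_mul_apply (cp.j a) (toConv (zeta cp f)) g))
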